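/- Let T be an incomplete table over schema R and K ⊆ R with |K| ≥ 2 such that every attribute of T has at least one non-⊥ value and the submultiset of K-total tuples of T satisfies sp⟨K⟩. Then g3(K) ≥ g5(K). -/

import Mathlib

/- Common framework: incomplete tables, strongly possible worlds and constraints.
   A tuple assigns each attribute a value in `Option V`, with `none` encoding the
   null marker ⊥.  In the degenerate case of an attribute whose active domain is
   empty, the fresh symbol `s` (outside all domains) is encoded by `none` in the
   strongly possible world: it is a single fixed symbol, equal only to itself and
   different from every domain value, exactly as `none` behaves. -/

namespace SPDB

variable {α V : Type} [DecidableEq α] [DecidableEq V]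

/-- A tuple over attribute type `α` with values in `V`; `none` is the null ⊥. -/
abbrev Tuple (α V : Type) := α → Option V

/-- An incomplete table: a finite multiset of tuples. -/
abbrev Table (α V : Type) := Multiset (Tuple α V)

/-- The active domain of attribute `A` in table `T`: the non-null values in column `A`. -/
def VD (T : Table α V) (A : α) : Finset V :=
  (T.filterMap fun t => t A).toFinset

/-- `t'` is a strongly possible extension of `t` w.r.t. the active domains of `T`:
non-null entries are kept, each null is replaced by an active domain value
(by the fresh symbol, encoded `none`, if the active domain is empty). -/
def spExt (T : Table α V) (t t' : Tuple α V) : Prop :=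
  ∀ A, (t A ≠ none → t' A = t A) ∧
       (t A = none → if (VD T A).Nonempty then ∃ v ∈ VD T A, t' A = some v
                     else t' A = none)

/-- `T'` is a strongly possible world of `T`. -/
def spWorld (T T' : Table α V) : Prop := Multiset.Rel (spExt T) T T'

/-- Two tuples agree on the attribute set `X`. -/
def agrees (X : Finset α) (t1 t2 : Tuple α V) : Prop := ∀ A ∈ X, t1 A = t2 A

/-- Weak similarity on the attribute set `X`. -/
def weakSim (X : Finset α) (t1 t2 : Tuple α V) : Prop :=
  ∀ A ∈ X, t1 A = t2 A ∨ t1 A = none ∨ t2 A = none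

/-- `t` is `X`-total: no nulls among the attributes of `X`. -/
def isTotal (X : Finset α) (t : Tuple α V) : Prop := ∀ A ∈ X, t A ≠ none

instance (X : Finset α) : DecidablePred (isTotal (V := V) X) := fun t =>
  decidable_of_iff (∀ A ∈ X, t A ≠ none) Iff.rfl

/-- Projection of a tuple to the attribute set `X` (nulls outside `X`). -/
def proj (X : Finset α) (t : Tuple α V) : Tuple α V :=
  fun A => if A ∈ X then t A else none

/-- A (complete) table satisfies the key `K`: tuple occurrences are pairwise distinct on `K`. -/
def keyOn (K : Finset α) (T' : Table α V) : Prop := (T'.map (proj K)).Nodup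

/-- A (complete) table satisfies the functional dependency `X → Y`. -/
def FD (X Y : Finset α) (T' : Table α V) : Prop :=
  ∀ t1 ∈ T', ∀ t2 ∈ T', agrees X t1 t2 → agrees Y t1 t2

/-- A (complete) table over schema `R` satisfies the multivalued dependency `X ↠ Y`. -/
def MVD (R X Y : Finset α) (T' : Table α V) : Prop :=
  ∀ t1 ∈ T', ∀ t2 ∈ T', agrees X t1 t2 →
    ∃ t ∈ T', agrees (X ∪ Y) t t1 ∧ agrees (X ∪ (R \ Y)) t t2

/-- A (complete) table satisfies the cross join `X × Y`. -/
def CJ (X Y : Finset α) (T' : Table α V) : Prop :=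
  ∀ t1 ∈ T', ∀ t2 ∈ T', ∃ t ∈ T', agrees X t t1 ∧ agrees Y t t2

/-- `K` is a strongly possible key of `T`: `sp⟨K⟩`. -/
def spKey (T : Table α V) (K : Finset α) : Prop :=
  ∃ T', spWorld T T' ∧ keyOn K T'

/-- The strongly possible functional dependency `X →_sp Y` holds in `T`. -/
def spFD (T : Table α V) (X Y : Finset α) : Prop :=
  ∃ T', spWorld T T' ∧ FD X Y T'

/-- The strongly possible multivalued dependency `X ↠_sp Y` holds in `T` over schema `R`. -/
def spMVD (R : Finset α) (T : Table α V) (X Y : Finset α) : Prop :=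
  ∃ T', spWorld T T' ∧ MVD R X Y T'

/-- The strongly possible cross join `X ×_sp Y` holds in `T`. -/
def spCJ (T : Table α V) (X Y : Finset α) : Prop :=
  ∃ T', spWorld T T' ∧ CJ X Y T'

/-- Lien's null multivalued dependency `X ↠ Y` over schema `R`. -/
def NMVD (R : Finset α) (T : Table α V) (X Y : Finset α) : Prop :=
  ∀ t1 ∈ T, ∀ t2 ∈ T, isTotal X t1 → isTotal X t2 → agrees X t1 t2 →
    ∃ t ∈ T, agrees (X ∪ Y) t t1 ∧ agrees (X ∪ (R \ Y)) t t2

/-- The minimum number of tuples whose removal from `T` makes `P` hold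
(`T = T₀ + S` means that `S` is a submultiset of `T` and `T₀ = T ∖ S`). -/
noncomputable def g3Card (T : Table α V) (P : Table α V → Prop) : ℕ :=
  sInf {n : ℕ | ∃ T₀ S : Table α V, T = T₀ + S ∧ P T₀ ∧ Multiset.card S = n}

/-- `g3`: the minimum, over submultisets `S` of `T` whose removal makes the
constraint `P` hold, of `|S|/|T|`. -/
noncomputable def g3 (T : Table α V) (P : Table α V → Prop) : ℚ :=
  (g3Card T P : ℚ) / (Multiset.card T : ℚ)

/-- The minimum number of tuples whose addition to `T` makes `P` hold. -/
noncomputable def g5Card (T : Table α V) (P : Table α V → Prop) : ℕ :=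
  sInf {n : ℕ | ∃ S : Table α V, P (T + S) ∧ Multiset.card S = n}

/-- `g5`: the minimum, over finite multisets `S` of tuples whose addition makes
the constraint `P` hold, of `|S|/|T|`. -/
noncomputable def g5 (T : Table α V) (P : Table α V → Prop) : ℚ :=
  (g5Card T P : ℚ) / (Multiset.card T : ℚ)

end SPDB

namespace SPDB

section Placement

variable {ι κ V : Type}

/-- The values available in column `A` from the sets `D` and the complete rows in `F`. -/
def avail (D : κ → Set V) (F : Finset (κ → V)) (A : κ) : Set V :=
  {v | v ∈ D A ∨ ∃ c ∈ F, c A = v}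

/-- The complete row `c` extends the partial row `t` and has all its values in `D`. -/
def Completes (D : κ → Set V) (t : κ → Option V) (c : κ → V) : Prop :=
  ∀ A, (∀ v, t A = some v → c A = v) ∧ c A ∈ D A

/-- The rows indexed by `G` have pairwise distinct completions `f`, with values available from
`D` and `F`, that also avoid the rows of `F`. -/
structure IsPlacement (D : κ → Set V) (t : ι → κ → Option V) (F : Finset (κ → V))
    (G : Finset ι) (f : ι → κ → V) : Prop where
  injOn : Set.InjOn f G
  completes : ∀ i ∈ G, Completes (avail D F) (t i) (f i)
  notMem : ∀ i ∈ G, f i ∉ F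

lemma avail_mono (D : κ → Set V) {F F' : Finset (κ → V)} (h : F ⊆ F') (A : κ) :
    avail D F A ⊆ avail D F' A := by
  rintro v (hv | ⟨c, hc, rfl⟩)
  · exact Or.inl hv
  · exact Or.inr ⟨c, h hc, rfl⟩

lemma Completes.mono {D D' : κ → Set V} (h : ∀ A, D A ⊆ D' A) {t : κ → Option V} {c : κ → V}
    (hc : Completes D t c) : Completes D' t c :=
  fun A => ⟨(hc A).1, h A (hc A).2⟩

/-- Adding one more row to a placement. -/
lemma IsPlacement.insert_row [DecidableEq ι] {D : κ → Set V} {t : ι → κ → Option V}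
    {F : Finset (κ → V)} {G : Finset ι} {f : ι → κ → V} (h : IsPlacement D t F G f)
    {b : ι} (hb : b ∉ G) {c : κ → V} (hc : Completes (avail D F) (t b) c) (hcF : c ∉ F)
    (hcG : ∀ i ∈ G, f i ≠ c) : IsPlacement D t F (insert b G) (Function.update f b c) := by
  have hne : ∀ i ∈ G, i ≠ b := fun i hi hib => hb (hib ▸ hi)
  refine ⟨?_, ?_, ?_⟩
  · intro i hi j hj hij
    rw [Finset.mem_coe, Finset.mem_insert] at hi hj
    rcases hi with rfl | hi <;> rcases hj with rfl | hj
    · rfl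
    · simp only [Function.update_self, Function.update_of_ne (hne j hj)] at hij
      exact absurd hij.symm (hcG j hj)
    · simp only [Function.update_self, Function.update_of_ne (hne i hi)] at hij
      exact absurd hij (hcG i hi)
    · simp only [Function.update_of_ne (hne i hi), Function.update_of_ne (hne j hj)] at hij
      exact h.injOn hi hj hij
  · intro i hi
    rcases Finset.mem_insert.1 hi with rfl | hi
    · simpa using hc
    · simpa [Function.update_of_ne (hne i hi)] using h.completes i hi
  · intro i hi
    rcases Finset.mem_insert.1 hi with rfl | hi
    · simpa using hcF
    · simpa [Function.update_of_ne (hne i hi)] using h.notMem i hi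

lemma IsPlacement.mono_left {D : κ → Set V} {t : ι → κ → Option V}
    {F : Finset (κ → V)} {G G' : Finset ι} {f : ι → κ → V} (h : IsPlacement D t F G f)
    (hG : G' ⊆ G) : IsPlacement D t F G' f :=
  ⟨h.injOn.mono (by exact_mod_cast hG), fun i hi => h.completes i (hG hi),
    fun i hi => h.notMem i (hG hi)⟩

/-- A placement that misses some row can either be enlarged, or be rearranged so that it misses
a row whose completion in a given placement of all rows uses unavailable values. -/
lemma IsPlacement.exists_augment [DecidableEq ι] [Fintype ι] {D : κ → Set V}
    {t : ι → κ → Option V} {F Q : Finset (κ → V)} (hFQ : F ⊆ Q) {W : ι → κ → V}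
    (hW : IsPlacement D t Q Finset.univ W) {G : Finset ι} {f : ι → κ → V}
    (h : IsPlacement D t F G f) (hG : G ≠ Finset.univ) :
    ∃ G' f', IsPlacement D t F G' f' ∧ (G.card < G'.card ∨ G.card = G'.card ∧
      ∃ b ∉ G', ¬ Completes (avail D F) (t b) (W b)) := by
  classical
  induction hn : (G.filter fun i => f i ≠ W i).card using Nat.strong_induction_on
    generalizing G f with
  | _ n ih =>
  obtain ⟨b, hb⟩ : ∃ b, b ∉ G := by
    by_contra! hall
    exact hG (Finset.eq_univ_iff_forall.2 hall)
  by_cases hc : Completes (avail D F) (t b) (W b)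
  swap
  · exact ⟨G, f, h, Or.inr ⟨rfl, b, hb, hc⟩⟩
  have hWF : W b ∉ F := fun hm => hW.notMem b (Finset.mem_univ b) (hFQ hm)
  by_cases hocc : ∃ k ∈ G, f k = W b
  swap
  · push Not at hocc
    exact ⟨_, _, h.insert_row hb hc hWF hocc, Or.inl (by simp [hb])⟩
  obtain ⟨k, hk, hfk⟩ := hocc
  have hkb : k ≠ b := fun e => hb (e ▸ hk)
  have hb' : b ∉ G.erase k := fun hm => hb (Finset.mem_of_mem_erase hm)
  have h' : IsPlacement D t F (insert b (G.erase k)) (Function.update f b (W b)) := by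
    refine (h.mono_left (Finset.erase_subset k G)).insert_row hb' hc hWF fun i hi e => ?_
    exact Finset.ne_of_mem_erase hi (h.injOn (Finset.mem_of_mem_erase hi) hk (e.trans hfk.symm))
  have hcard : (insert b (G.erase k)).card = G.card := by
    rw [Finset.card_insert_of_notMem hb', Finset.card_erase_add_one hk]
  have hne : insert b (G.erase k) ≠ Finset.univ := by
    intro e
    have hm : k ∈ insert b (G.erase k) := e ▸ Finset.mem_univ k
    simp [hkb] at hm
  have hlt : ((insert b (G.erase k)).filter
      fun i => Function.update f b (W b) i ≠ W i).card < n := by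
    rw [← hn]
    refine Finset.card_lt_card (Finset.ssubset_iff_of_subset ?_ |>.2 ⟨k, ?_, ?_⟩)
    · intro i hi
      rw [Finset.mem_filter] at hi ⊢
      obtain ⟨hi, hne⟩ := hi
      by_cases hib : i = b
      · subst hib
        simp at hne
      · rw [Function.update_of_ne hib] at hne
        exact ⟨Finset.mem_of_mem_erase (Finset.mem_of_mem_insert_of_ne hi hib), hne⟩
    · refine Finset.mem_filter.2 ⟨hk, fun e => hkb ?_⟩
      exact hW.injOn (by simp) (by simp) (e.symm.trans hfk)
    · simp [hkb]
  obtain ⟨G', f', hp, hcase⟩ := ih _ hlt h' hne rfl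
  rw [hcard] at hcase
  exact ⟨G', f', hp, hcase⟩

/-- If all rows can be placed after adding some complete rows `Q ⊇ F`, then one further complete
row is enough to place an additional row, keeping the possibility of placing all of them. -/
lemma IsPlacement.exists_step [DecidableEq ι] [Fintype ι] {D : κ → Set V}
    {t : ι → κ → Option V} (hD : ∀ A, (D A).Nonempty) (ht : ∀ i A v, t i A = some v → v ∈ D A)
    {F Q : Finset (κ → V)} (hFQ : F ⊆ Q) {W : ι → κ → V}
    (hW : IsPlacement D t Q Finset.univ W) {G : Finset ι} {f : ι → κ → V}
    (h : IsPlacement D t F G f) (hG : G ≠ Finset.univ) :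
    ∃ F' Q' W' G' f', F' ⊆ Q' ∧ IsPlacement D t Q' Finset.univ W' ∧ IsPlacement D t F' G' f' ∧
      F'.card ≤ F.card + 1 ∧ G.card < G'.card := by
  classical
  obtain ⟨G, f, h, hcase | ⟨hcard, b, hb, hnc⟩⟩ := IsPlacement.exists_augment hFQ hW h hG
  · exact ⟨F, Q, W, G, f, hFQ, hW, h, by omega, hcase⟩
  have hWb := hW.completes b (Finset.mem_univ b)
  have hWQ := hW.notMem b (Finset.mem_univ b)
  obtain ⟨A, hA⟩ : ∃ A, W b A ∉ avail D F A := by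
    by_contra! hall
    exact hnc fun A => ⟨(hWb A).1, hall A⟩
  obtain ⟨s, hsQ, hsA⟩ : ∃ s ∈ Q, s A = W b A := by
    rcases (hWb A).2 with hv | hv
    · exact absurd (Or.inl hv) hA
    · exact hv
  have hsF : s ∉ F := fun hm => hA (Or.inr ⟨s, hm, hsA⟩)
  have hsW : s ≠ W b := fun e => hWQ (e ▸ hsQ)
  choose d hd using hD
  obtain ⟨c, hcA, hct, hcD⟩ : ∃ c : κ → V, c A = W b A ∧ (∀ B v, t b B = some v → c B = v) ∧
      ∀ B, B ≠ A → c B ∈ D B := by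
    refine ⟨Function.update (fun B => (t b B).getD (d B)) A (W b A), by simp, ?_, ?_⟩
    · intro B v hv
      by_cases hB : B = A
      · subst hB
        simpa using (hWb B).1 v hv
      · simp [Function.update_of_ne hB, hv]
    · intro B hB
      rw [Function.update_of_ne hB]
      cases hv : t b B with
      | none => exact hd B
      | some v => exact ht b B v hv
  have hocc : ∀ i ∈ G, f i ≠ c := by
    rintro i hi rfl
    exact hA (hcA ▸ (h.completes i hi A).2)
  have extend : ∀ s' : κ → V, s' A = W b A → c ≠ s' →
      IsPlacement D t (insert s' F) (insert b G) (Function.update f b c) := by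
    intro s' hs' hcs
    have h' : IsPlacement D t (insert s' F) G f := by
      refine ⟨h.injOn, fun i hi => (h.completes i hi).mono
        (avail_mono D (Finset.subset_insert s' F)), fun i hi hm => ?_⟩
      rcases Finset.mem_insert.1 hm with e | hm
      · exact hA (by rw [← hs', ← e]; exact (h.completes i hi A).2)
      · exact h.notMem i hi hm
    refine h'.insert_row hb (fun B => ⟨hct B, ?_⟩) ?_ hocc
    · by_cases hB : B = A
      · subst hB
        exact Or.inr ⟨s', Finset.mem_insert_self _ _, hs'.trans hcA.symm⟩
      · exact Or.inl (hcD B hB)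
    · intro hm
      rcases Finset.mem_insert.1 hm with e | hm
      · exact hcs e
      · exact hA (Or.inr ⟨c, hm, hcA⟩)
  have hGb : G.card < (insert b G).card := by simp [hb]
  by_cases hcs : c = s
  swap
  · exact ⟨insert s F, Q, W, insert b G, _, Finset.insert_subset hsQ hFQ, hW, extend s hsA hcs,
      Finset.card_insert_le _ _, hcard ▸ hGb⟩
  subst hcs
  have hsub : ∀ B, avail D Q B ⊆ avail D (insert (W b) (Q.erase c)) B := by
    rintro B v (hv | ⟨q, hq, rfl⟩)
    · exact Or.inl hv
    · by_cases hqc : q = c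
      · subst hqc
        by_cases hB : B = A
        · subst hB
          exact Or.inr ⟨W b, Finset.mem_insert_self _ _, hcA.symm⟩
        · exact Or.inl (hcD B hB)
      · exact Or.inr ⟨q, Finset.mem_insert_of_mem (Finset.mem_erase.2 ⟨hqc, hq⟩), rfl⟩
  have hW' : IsPlacement D t (insert (W b) (Q.erase c)) (Finset.univ.erase b) W := by
    refine ⟨hW.injOn.mono (by simp), fun i _ => (hW.completes i (Finset.mem_univ i)).mono hsub,
      fun i hi hm => ?_⟩
    rcases Finset.mem_insert.1 hm with e | hm
    · exact Finset.ne_of_mem_erase hi (hW.injOn (by simp) (by simp) e)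
    · exact hW.notMem i (Finset.mem_univ i) (Finset.mem_of_mem_erase hm)
  have hW'' := hW'.insert_row (Finset.notMem_erase b Finset.univ) (c := c)
    (fun B => ⟨hct B, hsub B (Or.inr ⟨c, hsQ, rfl⟩)⟩) (by simp [hsW])
    (fun i _ e => hW.notMem i (Finset.mem_univ i) (e ▸ hsQ))
  rw [Finset.insert_erase (Finset.mem_univ b)] at hW''
  refine ⟨insert (W b) F, insert (W b) (Q.erase c), _, insert b G, _, ?_, hW'',
    extend (W b) rfl hsW, Finset.card_insert_le _ _, hcard ▸ hGb⟩
  exact Finset.insert_subset_insert _ fun x hx =>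
    Finset.mem_erase.2 ⟨fun e => hsF (e ▸ hx), hFQ hx⟩

/-- If all rows can be placed after adding some complete rows, then it suffices to add as many
complete rows as are missed by a given placement. -/
lemma IsPlacement.exists_complete [DecidableEq ι] [Fintype ι] {D : κ → Set V}
    {t : ι → κ → Option V} (hD : ∀ A, (D A).Nonempty) (ht : ∀ i A v, t i A = some v → v ∈ D A)
    {F Q : Finset (κ → V)} (hFQ : F ⊆ Q) {W : ι → κ → V}
    (hW : IsPlacement D t Q Finset.univ W) {G : Finset ι} {f : ι → κ → V}
    (h : IsPlacement D t F G f) :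
    ∃ F' f', IsPlacement D t F' Finset.univ f' ∧ F'.card + G.card ≤ F.card + Fintype.card ι := by
  induction hn : Fintype.card ι - G.card using Nat.strong_induction_on
    generalizing F Q W G f with
  | _ n ih =>
  by_cases hG : G = Finset.univ
  · subst hG
    exact ⟨F, f, h, by simp⟩
  obtain ⟨F', Q', W', G', f', hsub, hW', h', hF, hlt⟩ := IsPlacement.exists_step hD ht hFQ hW h hG
  have hle := Finset.card_le_univ G'
  obtain ⟨F'', f'', hp, hle'⟩ := ih _ (by omega) hsub hW' h' rfl
  exact ⟨F'', f'', hp, by omega⟩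

end Placement

lemma mem_VD {α V : Type} [DecidableEq V] {T : Table α V} {A : α} {v : V} :
    v ∈ VD T A ↔ ∃ t ∈ T, t A = some v := by
  simp [VD]

lemma spExt.exists_mem {α V : Type} [DecidableEq V] {T : Table α V} {t t' : Tuple α V}
    (h : spExt T t t') (ht : t ∈ T) {A : α} (hA : (VD T A).Nonempty) :
    ∃ v ∈ VD T A, t' A = some v := by
  cases hv : t A with
  | none => simpa [hA] using (h A).2 hv
  | some v => exact ⟨v, mem_VD.2 ⟨t, ht, hv⟩, by rw [(h A).1 (by simp [hv]), hv]⟩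

lemma spExt.eq_none {α V : Type} [DecidableEq V] {T : Table α V} {t t' : Tuple α V}
    (h : spExt T t t') (ht : t ∈ T) {A : α} (hA : ¬ (VD T A).Nonempty) : t' A = none := by
  cases hv : t A with
  | none => simpa [hA] using (h A).2 hv
  | some v => exact absurd ⟨v, mem_VD.2 ⟨t, ht, hv⟩⟩ hA

lemma exists_spExt {α V : Type} [DecidableEq α] [DecidableEq V] (T : Table α V) (K : Finset α)
    (t : Tuple α V) (e : {A // A ∈ K} → V)
    (he : Completes (fun A => {v | v ∈ VD T A.1}) (fun A => t A.1) e) :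
    ∃ t', spExt T t t' ∧ ∀ A : {A // A ∈ K}, t' A.1 = some (e A) := by
  have key : ∀ A, ∃ x : Option V, ((t A ≠ none → x = t A) ∧
       (t A = none → if (VD T A).Nonempty then ∃ v ∈ VD T A, x = some v else x = none)) ∧
       ∀ hA : A ∈ K, x = some (e ⟨A, hA⟩) := by
    intro A
    by_cases hA : A ∈ K
    · obtain ⟨h1, h2⟩ := he ⟨A, hA⟩
      refine ⟨some (e ⟨A, hA⟩), ⟨fun hne => ?_, fun _ => ?_⟩, fun _ => rfl⟩
      · obtain ⟨v, hv⟩ := Option.ne_none_iff_exists'.1 hne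
        rw [h1 v hv, hv]
      · have hne : (VD T A).Nonempty := ⟨_, h2⟩
        rw [if_pos hne]
        exact ⟨_, h2, rfl⟩
    · by_cases hn : t A = none
      · by_cases hne : (VD T A).Nonempty
        · obtain ⟨v, hv⟩ := hne
          refine ⟨some v, ⟨fun h => absurd hn h, fun _ => ?_⟩, fun h => absurd h hA⟩
          rw [if_pos ⟨v, hv⟩]
          exact ⟨v, hv, rfl⟩
        · exact ⟨none, ⟨fun h => absurd hn h, fun _ => by rw [if_neg hne]⟩, fun h => absurd h hA⟩
      · exact ⟨t A, ⟨fun _ => rfl, fun h => absurd h hn⟩, fun h => absurd h hA⟩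
  choose t' h1 h2 using key
  exact ⟨t', h1, fun A => h2 A.1 A.2⟩

lemma rel_nodup_exists_map {ι β : Type} [DecidableEq ι] [Nonempty β] {r : ι → β → Prop}
    {s : Multiset ι} {m : Multiset β} (h : Multiset.Rel r s m) (hs : s.Nodup) :
    ∃ w : ι → β, m = s.map w ∧ ∀ i ∈ s, r i (w i) := by
  induction h with
  | zero => exact ⟨fun _ => Classical.arbitrary β, by simp⟩
  | @cons a b s m hab _ ih =>
    obtain ⟨ha, hs⟩ := Multiset.nodup_cons.1 hs
    obtain ⟨w, rfl, hw⟩ := ih hs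
    have hne : ∀ i ∈ s, i ≠ a := fun i hi e => ha (e ▸ hi)
    refine ⟨Function.update w a b, ?_, ?_⟩
    · rw [Multiset.map_cons, Function.update_self]
      congr 1
      exact Multiset.map_congr rfl fun i hi => (Function.update_of_ne (hne i hi) _ _).symm
    · intro i hi
      rcases Multiset.mem_cons.1 hi with rfl | hi
      · simpa using hab
      · simpa [Function.update_of_ne (hne i hi)] using hw i hi

/-- Strongly possible keys of an indexed table. -/
lemma spKey_map_iff {ι α V : Type} [Fintype ι] [DecidableEq α] [DecidableEq V]
    (u : ι → Tuple α V) (K : Finset α) :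
    spKey (Finset.univ.val.map u) K ↔ ∃ w : ι → Tuple α V,
      (∀ i, spExt (Finset.univ.val.map u) (u i) (w i)) ∧
        ∀ i j, (∀ A ∈ K, w i A = w j A) → i = j := by
  classical
  have hproj : ∀ x y : Tuple α V, proj K x = proj K y ↔ ∀ A ∈ K, x A = y A := by
    intro x y
    constructor
    · intro h A hA
      simpa [proj, hA] using congrFun h A
    · intro h
      funext A
      by_cases hA : A ∈ K
      · simp [proj, hA, h A hA]
      · simp [proj, hA]
  constructor
  · rintro ⟨T', hT', hkey⟩
    rw [spWorld, Multiset.rel_map_left] at hT'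
    obtain ⟨w, rfl, hw⟩ := rel_nodup_exists_map hT' Finset.univ.nodup
    refine ⟨w, fun i => hw i (Finset.mem_univ i), fun i j hij => ?_⟩
    rw [keyOn, Multiset.map_map] at hkey
    exact Multiset.inj_on_of_nodup_map hkey i (Finset.mem_univ i) j (Finset.mem_univ j)
      ((hproj _ _).2 hij)
  · rintro ⟨w, hw, hinj⟩
    refine ⟨Finset.univ.val.map w, ?_, ?_⟩
    · rw [spWorld, Multiset.rel_map]
      exact Multiset.rel_refl_of_refl_on fun i _ => hw i
    · rw [keyOn, Multiset.map_map]
      exact Finset.univ.nodup.map fun i j hij => hinj i j ((hproj _ _).1 hij)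

lemma exists_eq_univ_map {β : Type} (m : Multiset β) :
    ∃ (n : ℕ) (u : Fin n → β), m = Finset.univ.val.map u := by
  induction m using Quotient.inductionOn with
  | _ l => exact ⟨l.length, l.get, by rw [Fin.univ_val_map, List.ofFn_get]; rfl⟩

lemma univ_map_sum {ι ι' β : Type} [Fintype ι] [Fintype ι'] (u : ι → β) (u' : ι' → β) :
    (Finset.univ : Finset (ι ⊕ ι')).val.map (Sum.elim u u') =
      Finset.univ.val.map u + Finset.univ.val.map u' := by
  rw [← Finset.univ_disjSum_univ, Finset.val_disjSum, Multiset.disjSum]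
  simp

/-- If removing `S` makes `K` a strongly possible key and some addition does, then already an
addition of at most `|S|` tuples does. -/
theorem exists_add_spKey_card_le {α V : Type} [DecidableEq α] [DecidableEq V] (K : Finset α)
    (T₀ S Q : Table α V) (hVD : ∀ A ∈ K, (VD (T₀ + S) A).Nonempty)
    (hT₀ : spKey T₀ K) (hQ : spKey (T₀ + S + Q) K) :
    ∃ S' : Table α V, spKey (T₀ + S + S') K ∧ Multiset.card S' ≤ Multiset.card S := by
  obtain ⟨n, u, hu⟩ := exists_eq_univ_map T₀
  obtain ⟨m, x, hx⟩ := exists_eq_univ_map S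
  obtain ⟨k, q, hq⟩ := exists_eq_univ_map Q
  obtain ⟨w₀, hw₀, hinj₀⟩ := (spKey_map_iff u K).1 (hu ▸ hT₀)
  rw [← hu] at hw₀
  have hT : T₀ + S = Finset.univ.val.map (Sum.elim u x) := by
    rw [univ_map_sum, ← hu, ← hx]
  set T := T₀ + S
  set t := Sum.elim u x
  have hTQ : T + Q = Finset.univ.val.map (Sum.elim t q) := by
    rw [univ_map_sum, ← hT, ← hq]
  obtain ⟨w, hw, hinj⟩ := (spKey_map_iff (Sum.elim t q) K).1 (hTQ ▸ hQ)
  rw [← hTQ] at hw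
  let D : {A // A ∈ K} → Set V := fun A => {v | v ∈ VD T A.1}
  let t' : Fin n ⊕ Fin m → {A // A ∈ K} → Option V := fun i A => t i A.1
  have hmemT : ∀ i, t i ∈ T := fun i => by
    rw [hT]
    exact Multiset.mem_map_of_mem _ (Finset.mem_univ i)
  have hmemT₀ : ∀ i, u i ∈ T₀ := fun i => by
    rw [hu]
    exact Multiset.mem_map_of_mem _ (Finset.mem_univ i)
  have hmemTQ : ∀ i, Sum.elim t q i ∈ T + Q := fun i => by
    rw [hTQ]
    exact Multiset.mem_map_of_mem _ (Finset.mem_univ i)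
  have hD : ∀ A, (D A).Nonempty := fun A => hVD A.1 A.2
  have ht' : ∀ i A v, t' i A = some v → v ∈ D A := fun i A v hv => mem_VD.2 ⟨t i, hmemT i, hv⟩
  have hVDQ : ∀ A ∈ K, (VD (T + Q) A).Nonempty := by
    intro A hA
    obtain ⟨v, hv⟩ := hVD A hA
    obtain ⟨y, hy, hyv⟩ := mem_VD.1 hv
    exact ⟨v, mem_VD.2 ⟨y, Multiset.mem_add.2 (Or.inl hy), hyv⟩⟩
  have hex : ∀ i, ∀ A : {A // A ∈ K}, ∃ v ∈ VD (T + Q) A.1, w i A.1 = some v :=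
    fun i A => (hw i).exists_mem (hmemTQ i) (hVDQ A.1 A.2)
  choose W hWmem hWeq using hex
  have hWinj : ∀ i j, W i = W j → i = j := fun i j hij =>
    hinj i j fun A hA => by rw [hWeq i ⟨A, hA⟩, hWeq j ⟨A, hA⟩, hij]
  have hWext : ∀ i (A : {A // A ∈ K}) v, Sum.elim t q i A.1 = some v → W i A = v := by
    intro i A v hv
    have h1 := (hw i A.1).1 (by simp [hv])
    rw [hv, hWeq i A] at h1
    exact Option.some.inj h1
  have hfull : IsPlacement D t' (Finset.univ.image fun j => W (Sum.inr j)) Finset.univ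
      (fun i => W (Sum.inl i)) := by
    refine ⟨fun i _ j _ hij => Sum.inl.inj (hWinj _ _ hij), fun i _ A => ⟨?_, ?_⟩, ?_⟩
    · exact fun v hv => hWext (Sum.inl i) A v hv
    · obtain ⟨y, hy, hyv⟩ := mem_VD.1 (hWmem (Sum.inl i) A)
      rcases Multiset.mem_add.1 hy with hy | hy
      · exact Or.inl (mem_VD.2 ⟨y, hy, hyv⟩)
      · rw [hq] at hy
        obtain ⟨j, -, rfl⟩ := Multiset.mem_map.1 hy
        exact Or.inr ⟨W (Sum.inr j), by simp, hWext (Sum.inr j) A _ hyv⟩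
    · intro i _ hm
      obtain ⟨j, -, hj⟩ := Finset.mem_image.1 hm
      simpa using hWinj _ _ hj
  choose d hd using hD
  let f : Fin n ⊕ Fin m → {A // A ∈ K} → V :=
    Sum.elim (fun i A => (w₀ i A.1).getD (d A)) (fun _ => d)
  have hpart : IsPlacement D t' ∅ (Finset.univ.map Function.Embedding.inl) f := by
    refine ⟨?_, ?_, by simp⟩
    · intro i hi j hj hij
      simp only [Finset.coe_map, Function.Embedding.inl_apply, Finset.coe_univ, Set.image_univ,
        Set.mem_range] at hi hj
      obtain ⟨i, rfl⟩ := hi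
      obtain ⟨j, rfl⟩ := hj
      congr 1
      refine hinj₀ i j fun A hA => ?_
      have hijA := congrFun hij ⟨A, hA⟩
      by_cases hne : (VD T₀ A).Nonempty
      · obtain ⟨v, -, hv⟩ := (hw₀ i).exists_mem (hmemT₀ i) hne
        obtain ⟨v', -, hv'⟩ := (hw₀ j).exists_mem (hmemT₀ j) hne
        simpa [f, hv, hv'] using hijA
      · rw [(hw₀ i).eq_none (hmemT₀ i) hne, (hw₀ j).eq_none (hmemT₀ j) hne]
    · intro i hi A
      obtain ⟨i, -, rfl⟩ := Finset.mem_map.1 hi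
      refine ⟨fun v hv => ?_, Or.inl ?_⟩
      · have hv' : u i A.1 = some v := hv
        have h1 := (hw₀ i A.1).1 (by simp [hv'])
        simp [f, h1, hv']
      · by_cases hne : (VD T₀ A.1).Nonempty
        · obtain ⟨v, hv, hv'⟩ := (hw₀ i).exists_mem (hmemT₀ i) hne
          obtain ⟨y, hy, hyv⟩ := mem_VD.1 hv
          have : f (Sum.inl i) A = v := by simp [f, hv']
          rw [Function.Embedding.inl_apply, this]
          exact mem_VD.2 ⟨y, Multiset.mem_add.2 (Or.inl hy), hyv⟩
        · have : f (Sum.inl i) A = d A := by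
            simp [f, (hw₀ i).eq_none (hmemT₀ i) hne]
          rw [Function.Embedding.inl_apply, this]
          exact hd A
  obtain ⟨F, g, hg, hcard⟩ := IsPlacement.exists_complete (fun A => ⟨d A, hd A⟩) ht'
    (Finset.empty_subset _) hfull hpart
  let r : {c // c ∈ F} → Tuple α V := fun c A => if hA : A ∈ K then some (c.1 ⟨A, hA⟩) else none
  refine ⟨Finset.univ.val.map r, ?_, ?_⟩
  swap
  · have hS : Multiset.card S = m := by simp [hx]
    rw [Multiset.card_map, Finset.card_val, Finset.card_univ, Fintype.card_coe]
    simp at hcard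
    omega
  have hU : T + Finset.univ.val.map r = Finset.univ.val.map (Sum.elim t r) := by
    rw [univ_map_sum, ← hT]
  have hrVD : ∀ (c : {c // c ∈ F}) (A : {A // A ∈ K}),
      c.1 A ∈ VD (T + Finset.univ.val.map r) A.1 := fun c A =>
    mem_VD.2 ⟨r c, Multiset.mem_add.2 (Or.inr (Multiset.mem_map_of_mem _ (Finset.mem_univ c))),
      by simp [r]⟩
  have hcomp : ∀ i, Completes (fun A : {A // A ∈ K} =>
      {v | v ∈ VD (T + Finset.univ.val.map r) A.1}) (fun A => Sum.elim t r i A.1)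
      (Sum.elim g (fun c => c.1) i) := by
    rintro (i | c)
    · refine (hg.completes i (Finset.mem_univ i)).mono ?_
      rintro A v (hv | ⟨c, hc, rfl⟩)
      · obtain ⟨y, hy, hyv⟩ := mem_VD.1 hv
        exact mem_VD.2 ⟨y, Multiset.mem_add.2 (Or.inl hy), hyv⟩
      · exact hrVD ⟨c, hc⟩ A
    · refine fun A => ⟨fun v hv => ?_, hrVD c A⟩
      simpa [r] using hv
  choose z hz hzK using fun i => exists_spExt _ K _ _ (hcomp i)
  rw [hU] at hz ⊢
  refine (spKey_map_iff _ K).2 ⟨z, hz, fun i j hij => ?_⟩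
  have heq : Sum.elim g (fun c : {c // c ∈ F} => c.1) i = Sum.elim g (fun c => c.1) j := by
    funext A
    have := hij A.1 A.2
    rw [hzK, hzK] at this
    exact Option.some.inj this
  rcases i with i | c <;> rcases j with j | c'
  · exact congrArg _ (hg.injOn (by simp) (by simp) heq)
  · exact absurd (show g i ∈ F from (show g i = c'.1 from heq) ▸ c'.2)
      (hg.notMem i (Finset.mem_univ i))
  · exact absurd (show g j ∈ F from (show c.1 = g j from heq) ▸ c.2)
      (hg.notMem j (Finset.mem_univ j))
  · exact congrArg _ (Subtype.ext heq)

end SPDB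

open SPDB in
/-- for `|K| ≥ 2`, if every attribute of the schema has a non-null
value in `T` and the `K`-total part of `T` satisfies `sp⟨K⟩`, then `g3(K) ≥ g5(K)`. -/
theorem statement1 {α V : Type} [DecidableEq α] [DecidableEq V]
    (R K : Finset α) (hK : K ⊆ R) (hK2 : 2 ≤ K.card) (T : Table α V)
    (hVD : ∀ A ∈ R, ∃ t ∈ T, t A ≠ none)
    (htot : spKey (T.filter (isTotal K)) K) :
    g5 T (fun U => spKey U K) ≤ g3 T (fun U => spKey U K) := by
  obtain ⟨T₀, S, hTS, hT₀, hS⟩ : g3Card T (fun U => spKey U K) ∈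
      {n : ℕ | ∃ T₀ S : Table α V, T = T₀ + S ∧ spKey T₀ K ∧ Multiset.card S = n} := by
    have h0 : spKey (0 : Table α V) K := ⟨0, Multiset.Rel.zero, by simp [keyOn]⟩
    exact Nat.sInf_mem ⟨Multiset.card T, 0, T, (zero_add T).symm, h0, rfl⟩
  have hle : g5Card T (fun U => spKey U K) ≤ g3Card T (fun U => spKey U K) := by
    by_cases hQ : ∃ Q, spKey (T + Q) K
    · obtain ⟨Q, hQ⟩ := hQ
      subst hTS
      have hVD' : ∀ A ∈ K, (VD (T₀ + S) A).Nonempty := by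
        intro A hA
        obtain ⟨t, ht, hne⟩ := hVD A (hK hA)
        obtain ⟨v, hv⟩ := Option.ne_none_iff_exists'.1 hne
        exact ⟨v, mem_VD.2 ⟨t, ht, hv⟩⟩
      obtain ⟨S', hS', hcard⟩ := exists_add_spKey_card_le K T₀ S Q hVD' hT₀ hQ
      rw [← hS]
      refine le_trans (Nat.sInf_le ?_) hcard
      exact ⟨S', hS', rfl⟩
    · have : {n : ℕ | ∃ Q : Table α V, spKey (T + Q) K ∧ Multiset.card Q = n} = ∅ :=
        Set.eq_empty_of_forall_notMem fun n ⟨Q, h, _⟩ => hQ ⟨Q, h⟩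
      simp [g5Card, this]
  unfold g5 g3
  gcongr
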